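/- Let Φ be an irreducible time-reversible Markov chain on finite state space Ω with π(x) = e^{-E(x)}/Z, collapsed stopping state s with weight Z_S, and return time ξ. Define the per-tour gradient reward G = E[ξ]·g₀ − Σ_{k=0}^{ξ−1} g(X(k)) for a bounded function g : Ω → ℝⁿ and constant vector g₀ (the positive statistics). Then E[G] = E[ξ]·(g₀ − Σ_x g(x)π(x)) = (Z/Z_S)·(g₀ − E_π[g]); i.e., the expected tour reward is proportional, with known positive factor Z/Z_S, to the true gradient direction g₀ − E_π[g]. -/

import Mathlib

open MeasureTheory

/-- First return time to `s`. -/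
noncomputable def retTime {Ω : Type*} (s : Ω) (ω : ℕ → Ω) : ℕ :=
  sInf {t : ℕ | 1 ≤ t ∧ ω t = s}

namespace LVS

/-- A set whose outer measure and that of its complement sum to at most one is null measurable. -/
lemma nullMeas {X : Type*} [MeasurableSpace X] (μ : Measure X) [IsProbabilityMeasure μ]
    (A : Set X) (h : μ A + μ Aᶜ ≤ 1) : NullMeasurableSet A μ := by
  have hT := measurableSet_toMeasurable μ A
  have hU := measurableSet_toMeasurable μ Aᶜ
  have hu : toMeasurable μ A ∪ toMeasurable μ Aᶜ = Set.univ := by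
    apply Set.eq_univ_of_forall
    intro x
    by_cases hx : x ∈ A
    · exact Or.inl (subset_toMeasurable μ A hx)
    · exact Or.inr (subset_toMeasurable μ Aᶜ hx)
  have h1 := measure_union_add_inter (μ := μ) (toMeasurable μ A) hU
  rw [hu, measure_univ, measure_toMeasurable, measure_toMeasurable] at h1
  have h2 : μ (toMeasurable μ A ∩ toMeasurable μ Aᶜ) = 0 := by
    have : (1 : ENNReal) + μ (toMeasurable μ A ∩ toMeasurable μ Aᶜ) ≤ 1 + 0 := by
      rw [h1, add_zero]; exact h
    exact le_antisymm ((ENNReal.add_le_add_iff_left ENNReal.one_ne_top).1 this) bot_le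
  have h3 : A =ᵐ[μ] toMeasurable μ A := by
    refine (subset_toMeasurable μ A).eventuallyLE.antisymm ?_
    rw [ae_le_set]
    refine measure_mono_null ?_ h2
    intro x hx
    exact ⟨hx.1, subset_toMeasurable μ Aᶜ hx.2⟩
  exact ⟨_, hT, h3⟩

section
variable {Ω : Type*} [Fintype Ω] [DecidableEq Ω]

/-- Path weight. -/
noncomputable def w (p : Ω → Ω → ℝ) (s : Ω) (m : ℕ) (f : Fin (m + 1) → Ω) : ℝ :=
  (if f 0 = s then 1 else 0) * ∏ i : Fin m, p (f i.castSucc) (f i.succ)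

lemma w_snoc (p : Ω → Ω → ℝ) (s : Ω) (m : ℕ) (f : Fin (m + 1) → Ω) (y : Ω) :
    w p s (m + 1) (Fin.snoc f y : Fin (m + 2) → Ω) = w p s m f * p (f (Fin.last m)) y := by
  unfold w
  rw [Fin.prod_univ_castSucc]
  have h0 : (Fin.snoc f y : Fin (m + 2) → Ω) 0 = f 0 := by
    have := Fin.snoc_castSucc (α := fun _ => Ω) y f 0
    simpa using this
  have h1 : ∀ i : Fin m, (Fin.snoc f y : Fin (m + 2) → Ω) i.castSucc.succ = f i.succ := by
    intro i
    rw [Fin.succ_castSucc]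
    exact Fin.snoc_castSucc (α := fun _ => Ω) y f i.succ
  have h2 : (Fin.snoc f y : Fin (m + 2) → Ω) (Fin.last m).succ = y := by
    rw [Fin.succ_last]
    exact Fin.snoc_last (α := fun _ => Ω) y f
  have h3 : ∀ i : Fin (m+1), (Fin.snoc f y : Fin (m + 2) → Ω) i.castSucc = f i := by
    intro i
    exact Fin.snoc_castSucc (α := fun _ => Ω) y f i
  simp only [h0, h1, h2, h3, mul_assoc]

lemma sum_snoc (m : ℕ) (F : (Fin (m + 2) → Ω) → ℝ) :
    ∑ f, F f = ∑ f : Fin (m + 1) → Ω, ∑ y, F (Fin.snoc f y : Fin (m + 2) → Ω) := by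
  rw [← Equiv.sum_comp (Fin.snocEquiv (fun _ => Ω)) F, Fintype.sum_prod_type, Finset.sum_comm]
  rfl

lemma sum_w (p : Ω → Ω → ℝ) (s : Ω) (h : ∀ x, ∑ y, p x y = 1) (m : ℕ) :
    ∑ f, w p s m f = 1 := by
  induction m with
  | zero =>
    rw [← Equiv.sum_comp (Equiv.funUnique (Fin 1) Ω).symm]
    simp [w, Equiv.funUnique]
  | succ m ih =>
    rw [sum_snoc]
    simp only [w_snoc, ← Finset.mul_sum, h, mul_one, ih]

variable [MeasurableSpace Ω]

lemma cyl (p : Ω → Ω → ℝ) (s : Ω) (h : ∀ x, ∑ y, p x y = 1)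
    (μ : Measure (ℕ → Ω)) [IsProbabilityMeasure μ]
    (hμ : ∀ (m : ℕ) (f : Fin (m + 1) → Ω),
      (μ {ω | ∀ i : Fin (m + 1), ω (i : ℕ) = f i}).toReal = w p s m f)
    (m : ℕ) (f : Fin (m + 1) → Ω) :
    NullMeasurableSet {ω : ℕ → Ω | ∀ i : Fin (m + 1), ω (i : ℕ) = f i} μ := by
  classical
  set C : (Fin (m + 1) → Ω) → Set (ℕ → Ω) := fun f => {ω | ∀ i : Fin (m + 1), ω (i : ℕ) = f i}
    with hC
  have htot : ∑ f, μ (C f) = 1 := by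
    rw [← ENNReal.toReal_eq_one_iff, ENNReal.toReal_sum (fun _ _ => measure_ne_top _ _)]
    rw [← sum_w p s h m]
    exact Finset.sum_congr rfl fun f _ => hμ m f
  apply nullMeas
  change μ (C f) + μ (C f)ᶜ ≤ 1
  rw [← htot, ← Finset.add_sum_erase _ _ (Finset.mem_univ f)]
  gcongr
  refine le_trans (measure_mono ?_) (measure_biUnion_finset_le _ _)
  intro ω hω
  simp only [Set.mem_iUnion]
  refine ⟨fun i => ω i, ?_, fun i => rfl⟩
  simp only [Finset.mem_erase, Finset.mem_univ, and_true]
  rintro rfl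
  exact hω fun i => rfl

open Classical in
lemma pred (p : Ω → Ω → ℝ) (s : Ω) (h : ∀ x, ∑ y, p x y = 1)
    (μ : Measure (ℕ → Ω)) [IsProbabilityMeasure μ]
    (hμ : ∀ (m : ℕ) (f : Fin (m + 1) → Ω),
      (μ {ω | ∀ i : Fin (m + 1), ω (i : ℕ) = f i}).toReal = w p s m f)
    (m : ℕ) (P : (Fin (m + 1) → Ω) → Prop) :
    NullMeasurableSet {ω : ℕ → Ω | P (fun i => ω i)} μ ∧
    μ.real {ω : ℕ → Ω | P (fun i => ω i)} = ∑ f, if P f then w p s m f else 0 := by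
  have heq : {ω : ℕ → Ω | P (fun i => ω i)} = ⋃ f ∈ Finset.univ.filter P,
      {ω : ℕ → Ω | ∀ i : Fin (m + 1), ω (i : ℕ) = f i} := by
    ext ω
    simp only [Set.mem_setOf_eq, Finset.mem_filter, Finset.mem_univ, true_and, Set.mem_iUnion]
    constructor
    · intro hP
      exact ⟨_, hP, fun i => rfl⟩
    · rintro ⟨f, hf, hi⟩
      have : (fun i : Fin (m + 1) => ω i) = f := funext hi
      rwa [this]
  rw [heq]
  constructor
  · exact Finset.nullMeasurableSet_biUnion _ fun f _ => cyl p s h μ hμ m f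
  · rw [Measure.real, measure_biUnion_finset₀, ENNReal.toReal_sum (fun _ _ => measure_ne_top _ _),
      ← Finset.sum_filter]
    · exact Finset.sum_congr rfl fun f _ => hμ m f
    · intro f _ f' _ hff
      apply Disjoint.aedisjoint
      rw [Set.disjoint_left]
      intro ω h1 h2
      exact hff (funext fun i => (h1 i).symm.trans (h2 i))
    · exact fun f _ => cyl p s h μ hμ m f

/-- Occupation at time `k` before return. -/
def A (s x : Ω) (k : ℕ) : Set (ℕ → Ω) := {ω | (∀ j, 1 ≤ j → j ≤ k → ω j ≠ s) ∧ ω k = x}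

open Classical in
/-- Good finite paths. -/
def good (s x : Ω) (k : ℕ) (f : Fin (k + 1) → Ω) : Prop :=
  (∀ j : Fin (k + 1), 1 ≤ (j : ℕ) → f j ≠ s) ∧ f (Fin.last k) = x

lemma A_eq (s x : Ω) (k : ℕ) : A s x k = {ω : ℕ → Ω | good s x k (fun i => ω i)} := by
  ext ω
  simp only [A, good, Set.mem_setOf_eq, Fin.val_last]
  refine and_congr_left fun _ => ⟨fun h j hj => h j hj (by omega), fun h j hj hk => ?_⟩
  exact h ⟨j, by omega⟩ hj

lemma good_snoc (s x : Ω) (k : ℕ) (f : Fin (k + 1) → Ω) (y : Ω) :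
    good s x (k + 1) (Fin.snoc f y : Fin (k + 2) → Ω) ↔
      (good s (f (Fin.last k)) k f ∧ y ≠ s ∧ y = x) := by
  have h2 : (Fin.snoc f y : Fin (k + 2) → Ω) (Fin.last (k + 1)) = y :=
    Fin.snoc_last (α := fun _ => Ω) y f
  have h3 : ∀ i : Fin (k+1), (Fin.snoc f y : Fin (k + 2) → Ω) i.castSucc = f i := by
    intro i
    exact Fin.snoc_castSucc (α := fun _ => Ω) y f i
  unfold good
  rw [Fin.forall_fin_succ']
  simp only [h2, h3, Fin.val_castSucc, Fin.val_last]
  constructor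
  · rintro ⟨⟨a, b⟩, c⟩
    exact ⟨⟨a, by trivial⟩, b (by omega), c⟩
  · rintro ⟨⟨a, -⟩, b, c⟩
    exact ⟨⟨a, fun _ => b⟩, c⟩

lemma A_null (p : Ω → Ω → ℝ) (s : Ω) (h : ∀ x, ∑ y, p x y = 1)
    (μ : Measure (ℕ → Ω)) [IsProbabilityMeasure μ]
    (hμ : ∀ (m : ℕ) (f : Fin (m + 1) → Ω),
      (μ {ω | ∀ i : Fin (m + 1), ω (i : ℕ) = f i}).toReal = w p s m f)
    (x : Ω) (k : ℕ) : NullMeasurableSet (A s x k) μ := by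
  rw [A_eq]; exact (pred p s h μ hμ k _).1

lemma A_zero (p : Ω → Ω → ℝ) (s : Ω) (h : ∀ x, ∑ y, p x y = 1)
    (μ : Measure (ℕ → Ω)) [IsProbabilityMeasure μ]
    (hμ : ∀ (m : ℕ) (f : Fin (m + 1) → Ω),
      (μ {ω | ∀ i : Fin (m + 1), ω (i : ℕ) = f i}).toReal = w p s m f)
    (x : Ω) : μ.real (A s x 0) = if x = s then 1 else 0 := by
  classical
  rw [A_eq, (pred p s h μ hμ 0 _).2, ← Equiv.sum_comp (Equiv.funUnique (Fin 1) Ω).symm]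
  simp [w, good, Equiv.funUnique]

lemma A_succ (p : Ω → Ω → ℝ) (s : Ω) (h : ∀ x, ∑ y, p x y = 1)
    (μ : Measure (ℕ → Ω)) [IsProbabilityMeasure μ]
    (hμ : ∀ (m : ℕ) (f : Fin (m + 1) → Ω),
      (μ {ω | ∀ i : Fin (m + 1), ω (i : ℕ) = f i}).toReal = w p s m f)
    (y : Ω) (k : ℕ) :
    μ.real (A s y (k + 1)) = if y = s then 0 else ∑ x, μ.real (A s x k) * p x y := by
  classical
  simp only [A_eq, (pred p s h μ hμ _ _).2]
  rw [sum_snoc]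
  simp only [good_snoc, w_snoc]
  split_ifs with hy
  · subst hy
    refine Finset.sum_eq_zero fun f _ => Finset.sum_eq_zero fun z _ => ?_
    rw [if_neg]
    rintro ⟨-, a, b⟩
    exact a b
  · simp only [Finset.sum_mul]
    rw [Finset.sum_comm (s := (Finset.univ : Finset Ω))]
    refine Finset.sum_congr rfl fun f _ => ?_
    rw [Finset.sum_eq_single y, Finset.sum_eq_single (f (Fin.last k))]
    · simp only [hy, ne_eq, not_false_eq_true, and_true, ite_mul, zero_mul]
    · intro b _ hb
      rw [if_neg, zero_mul]
      rintro ⟨-, hh⟩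
      exact hb hh.symm
    · simp
    · intro b _ hb
      rw [if_neg]
      rintro ⟨-, -, hh⟩
      exact hb hh
    · simp

end
end LVS

namespace LVS
open Filter Topology

lemma kac {Ω : Type*} [Fintype Ω] [DecidableEq Ω] (p : Ω → Ω → ℝ)
    (hstoch : ∀ x, (∀ y, 0 ≤ p x y) ∧ ∑ y, p x y = 1)
    (hirr : ∀ x y : Ω, ∃ n : ℕ, 0 < (Matrix.of p ^ n) x y)
    (s : Ω) (v : Ω → ℝ) (hv : ∀ x, 0 ≤ v x) (hvs : v s = 1) (hst : ∀ y, ∑ x, v x * p x y = v y)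
    (a : ℕ → Ω → ℝ) (hapos : ∀ k x, 0 ≤ a k x) (ha0 : ∀ x, a 0 x = if x = s then 1 else 0)
    (hs : ∀ k y, a (k + 1) y = if y = s then 0 else ∑ x, a k x * p x y) (x : Ω) :
    HasSum (fun k => a k x) (v x) := by
  set r : ℕ → Ω → ℝ := fun k x => v x - ∑ j ∈ Finset.range k, a j x with hr
  have hrs : ∀ k y, r (k + 1) y = if y = s then 0 else ∑ x, r k x * p x y := by
    intro k y
    simp only [hr]
    rw [Finset.sum_range_succ']
    simp only [hs, ha0]
    split_ifs with hy
    · subst hy; simp [hvs]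
    · simp only [sub_mul, Finset.sum_sub_distrib, hst, Finset.sum_mul]
      rw [Finset.sum_comm]; simp
  have hrpos : ∀ k y, 0 ≤ r k y := by
    intro k
    induction k with
    | zero => intro y; simpa [hr] using hv y
    | succ k ih =>
      intro y
      rw [hrs]
      split_ifs
      · exact le_rfl
      · exact Finset.sum_nonneg fun x _ => mul_nonneg (ih x) ((hstoch x).1 y)
  have hsum : ∀ x, Summable fun k => a k x := fun x =>
    summable_of_sum_range_le (c := v x) (fun k => hapos k x) fun k => by
      have := hrpos k x
      simp only [hr] at this
      linarith
  set R : Ω → ℝ := fun x => v x - ∑' k, a k x with hR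
  have hlim : ∀ x, Tendsto (fun k => r k x) atTop (𝓝 (R x)) := fun x =>
    tendsto_const_nhds.sub (hsum x).hasSum.tendsto_sum_nat
  have hRpos : ∀ x, 0 ≤ R x := fun x => ge_of_tendsto' (hlim x) fun k => hrpos k x
  have hRs : R s = 0 := by
    refine tendsto_nhds_unique ((tendsto_add_atTop_iff_nat 1).2 (hlim s)) ?_
    simp only [hrs, if_true]
    exact tendsto_const_nhds
  have hRq : ∀ y, y ≠ s → R y = ∑ x, R x * p x y := by
    intro y hy
    refine tendsto_nhds_unique ((tendsto_add_atTop_iff_nat 1).2 (hlim y)) ?_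
    simp only [hrs, if_neg hy]
    exact tendsto_finsetSum _ fun x _ => (hlim x).mul_const _
  have hz : ∑ x, R x * p x s = 0 := by
    have h1 : ∑ y, ∑ x, R x * p x y = ∑ y, R y := by
      rw [Finset.sum_comm]
      simp only [← Finset.mul_sum, (hstoch _).2, mul_one]
    rw [← Finset.add_sum_erase _ _ (Finset.mem_univ s),
      ← Finset.add_sum_erase _ R (Finset.mem_univ s), hRs,
      ← Finset.sum_congr rfl fun y hy => hRq y (Finset.ne_of_mem_erase hy)] at h1
    linarith
  have hRP : ∀ y, ∑ x, R x * p x y = R y := by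
    intro y
    by_cases hy : y = s
    · subst hy; rw [hz, hRs]
    · exact (hRq y hy).symm
  have hpow : ∀ (n : ℕ) y, ∑ x, R x * (Matrix.of p ^ n) x y = R y := by
    intro n
    induction n with
    | zero => intro y; simp [Matrix.one_apply]
    | succ n ih =>
      intro y
      simp only [pow_succ, Matrix.mul_apply, Finset.mul_sum, ← mul_assoc]
      rw [Finset.sum_comm]
      simp only [← Finset.sum_mul, ih, Matrix.of_apply, hRP]
  have hpp : ∀ (n : ℕ) x y, 0 ≤ (Matrix.of p ^ n) x y := by
    intro n
    induction n with
    | zero => intro x y; simp only [pow_zero, Matrix.one_apply]; split_ifs <;> norm_num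
    | succ n ih =>
      intro x y
      simp only [pow_succ, Matrix.mul_apply]
      exact Finset.sum_nonneg fun z _ => mul_nonneg (ih x z) ((hstoch z).1 y)
  have hR0 : R x = 0 := by
    obtain ⟨n, hn⟩ := hirr x s
    have h1 := hpow n s
    rw [hRs, Finset.sum_eq_zero_iff_of_nonneg fun z _ => mul_nonneg (hRpos z) (hpp n z s)] at h1
    have := h1 x (Finset.mem_univ x)
    rcases mul_eq_zero.1 this with h | h
    · exact h
    · exact absurd h hn.ne'
  have : v x = ∑' k, a k x := by
    have : v x - ∑' k, a k x = 0 := hR0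
    linarith
  rw [this]
  exact (hsum x).hasSum

lemma mem_A_iff {Ω : Type*} (s x : Ω) (ω : ℕ → Ω) (k : ℕ) (hret : ∃ t, 1 ≤ t ∧ ω t = s) :
    ω ∈ A s x k ↔ k < retTime s ω ∧ ω k = x := by
  unfold A retTime
  simp only [Set.mem_ofPred_eq]
  refine and_congr_left fun _ => ⟨fun h => ?_, fun h j hj hjk he => ?_⟩
  · by_contra hlt
    have := Nat.sInf_mem (s := {t : ℕ | 1 ≤ t ∧ ω t = s}) hret
    exact h _ this.1 (not_lt.1 hlt) this.2
  · have := Nat.sInf_le (s := {t : ℕ | 1 ≤ t ∧ ω t = s}) ⟨hj, he⟩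
    omega

lemma tour {Ω : Type*} [Fintype Ω] [DecidableEq Ω] [MeasurableSpace Ω] (s : Ω)
    (μ : Measure (ℕ → Ω)) [IsProbabilityMeasure μ] (v : Ω → ℝ)
    (hA : ∀ x k, NullMeasurableSet (A s x k) μ)
    (hsum : ∀ x, HasSum (fun k => μ.real (A s x k)) (v x))
    {F : Type*} [NormedAddCommGroup F] [NormedSpace ℝ F] [CompleteSpace F] (h : Ω → F) :
    Integrable (fun ω => ∑ k ∈ Finset.range (retTime s ω), h (ω k)) μ ∧
    ∫ ω, ∑ k ∈ Finset.range (retTime s ω), h (ω k) ∂μ = ∑ x, v x • h x := by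
  classical
  have hret : ∀ᵐ ω ∂μ, ∃ t, 1 ≤ t ∧ ω t = s := by
    have hle : ∀ k, μ.real {ω | ¬ ∃ t, 1 ≤ t ∧ ω t = s} ≤ ∑ x, μ.real (A s x k) := by
      intro k
      refine le_trans (measureReal_mono ?_ (measure_ne_top _ _))
        (measureReal_biUnion_finset_le Finset.univ fun x => A s x k)
      intro ω hω
      simp only [Set.mem_iUnion]
      exact ⟨ω k, Finset.mem_univ _, fun j hj _ he => hω ⟨j, hj, he⟩, rfl⟩
    have ht : Tendsto (fun k => ∑ x, μ.real (A s x k)) atTop (𝓝 (∑ x : Ω, (0 : ℝ))) :=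
      tendsto_finsetSum _ fun x _ => (hsum x).summable.tendsto_atTop_zero
    rw [Finset.sum_const_zero] at ht
    have h0 := ge_of_tendsto' ht hle
    have h1 : μ.real {ω | ¬ ∃ t, 1 ≤ t ∧ ω t = s} = 0 := le_antisymm h0 measureReal_nonneg
    rw [measureReal_eq_zero_iff] at h1
    exact h1
  set G : ℕ → (ℕ → Ω) → F := fun k ω => ∑ x, (A s x k).indicator (fun _ => h x) ω with hG
  have hi : ∀ x k, Integrable ((A s x k).indicator (fun _ => h x)) μ := fun x k =>
    (integrable_const (h x)).indicator₀ (hA x k)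
  have hGi : ∀ k, Integrable (G k) μ := fun k => integrable_finsetSum _ fun x _ => hi x k
  have hGint : ∀ k, ∫ ω, G k ω ∂μ = ∑ x, μ.real (A s x k) • h x := by
    intro k
    rw [integral_finsetSum _ fun x _ => hi x k]
    refine Finset.sum_congr rfl fun x _ => ?_
    rw [integral_indicator₀ (hA x k), setIntegral_const]
  have hGn : ∀ k, ∫ ω, ‖G k ω‖ ∂μ ≤ ∑ x, μ.real (A s x k) * ‖h x‖ := by
    intro k
    have : ∑ x, μ.real (A s x k) * ‖h x‖ =
        ∫ ω, ∑ x, ‖(A s x k).indicator (fun _ => h x) ω‖ ∂μ := by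
      rw [integral_finsetSum _ fun x _ => (hi x k).norm]
      refine Finset.sum_congr rfl fun x _ => ?_
      simp only [norm_indicator_eq_indicator_norm]
      rw [integral_indicator₀ (hA x k), setIntegral_const, smul_eq_mul]
    rw [this]
    exact integral_mono (hGi k).norm (integrable_finsetSum _ fun x _ => (hi x k).norm)
      fun ω => norm_sum_le _ _
  have hGs : Summable fun k => ∫ ω, ‖G k ω‖ ∂μ :=
    Summable.of_nonneg_of_le (fun k => integral_nonneg fun ω => norm_nonneg _) hGn
      (summable_sum fun x _ => (hsum x).summable.mul_right _)
  have hGe : ∀ ω : ℕ → Ω, (∃ t, 1 ≤ t ∧ ω t = s) → ∀ k,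
      G k ω = if k < retTime s ω then h (ω k) else 0 := by
    intro ω hω k
    simp only [hG, Set.indicator_apply, mem_A_iff s _ ω k hω]
    split_ifs with hk
    · simp [hk]
    · simp [hk]
  have hfin : ∀ ω : ℕ → Ω, (∃ t, 1 ≤ t ∧ ω t = s) →
      HasSum (fun k => G k ω) (∑ k ∈ Finset.range (retTime s ω), h (ω k)) := by
    intro ω hω
    have : ∑ k ∈ Finset.range (retTime s ω), h (ω k) =
        ∑ k ∈ Finset.range (retTime s ω), G k ω :=
      Finset.sum_congr rfl fun k hk => by rw [hGe ω hω, if_pos (Finset.mem_range.1 hk)]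
    rw [this]
    refine hasSum_sum_of_ne_finset_zero fun k hk => ?_
    rw [hGe ω hω, if_neg (by simpa using hk)]
  constructor
  · refine ⟨aestronglyMeasurable_of_tendsto_ae atTop
      (f := fun n ω => ∑ k ∈ Finset.range n, G k ω)
      (fun n => (integrable_finsetSum _ fun k _ => hGi k).aestronglyMeasurable) ?_, ?_⟩
    · filter_upwards [hret] with ω hω
      exact (hfin ω hω).tendsto_sum_nat
    · have hle : ∫⁻ ω, ‖∑ k ∈ Finset.range (retTime s ω), h (ω k)‖ₑ ∂μ
          ≤ ∫⁻ ω, ∑' k, ‖G k ω‖ₑ ∂μ := by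
        refine lintegral_mono_ae ?_
        filter_upwards [hret] with ω hω
        rw [← Finset.sum_congr rfl fun k hk => (hGe ω hω k).trans
          (if_pos (Finset.mem_range.1 hk))]
        exact (enorm_sum_le _ _).trans (ENNReal.sum_le_tsum _)
      refine lt_of_le_of_lt hle ?_
      rw [lintegral_tsum fun k => (hGi k).aestronglyMeasurable.enorm]
      have : ∀ k, ∫⁻ ω, ‖G k ω‖ₑ ∂μ = ENNReal.ofReal (∫ ω, ‖G k ω‖ ∂μ) := fun k =>
        (ofReal_integral_norm_eq_lintegral_enorm (hGi k)).symm
      simp only [this]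
      exact hGs.tsum_ofReal_lt_top
  · have h1 := hasSum_integral_of_summable_integral_norm hGi hGs
    have h2 : ∫ ω, ∑' k, G k ω ∂μ = ∫ ω, ∑ k ∈ Finset.range (retTime s ω), h (ω k) ∂μ := by
      refine integral_congr_ae ?_
      filter_upwards [hret] with ω hω
      exact (hfin ω hω).tsum_eq
    rw [h2] at h1
    simp only [hGint] at h1
    exact h1.unique (hasSum_sum fun x _ => (hsum x).smul_const (h x))

end LVS

/-- **Unbiasedness of the LVS gradient-direction estimator.** For an
irreducible time-reversible chain with stationary distribution
`π x = exp (-E x) / Z` started at the collapsed stopping state `s` with weight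
`Z_S = exp (-E s)`, the per-tour gradient reward
`G = E[ξ] • g₀ − Σ_{k<ξ} g(X k)` (with `g : Ω → ℝⁿ` the negative-phase
statistics and `g₀` the positive statistics) satisfies
`E[G] = E[ξ] • (g₀ − E_π[g]) = (Z/Z_S) • (g₀ − E_π[g])`: the expected tour
reward is the true gradient direction scaled by the known positive factor
`Z/Z_S`. -/
theorem stmt18 {Ω : Type*} [Fintype Ω] [DecidableEq Ω] [MeasurableSpace Ω]
    (p : Ω → Ω → ℝ) (E : Ω → ℝ)
    (hstoch : ∀ x, (∀ y, 0 ≤ p x y) ∧ ∑ y, p x y = 1)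
    (hirr : ∀ x y : Ω, ∃ n : ℕ, 0 < (Matrix.of p ^ n) x y)
    (Z : ℝ) (hZ : Z = ∑ y, Real.exp (-E y))
    (π : Ω → ℝ) (hπ : ∀ x, π x = Real.exp (-E x) / Z)
    (hrev : ∀ x y, π x * p x y = π y * p y x)
    (hπstat : ∀ y, ∑ x, π x * p x y = π y)
    (s : Ω) (ZS : ℝ) (hZS : ZS = Real.exp (-E s))
    (μ : Measure (ℕ → Ω)) [IsProbabilityMeasure μ]
    (hμ : ∀ (m : ℕ) (f : Fin (m + 1) → Ω),
      (μ {ω | ∀ i : Fin (m + 1), ω (i : ℕ) = f i}).toReal =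
        (if f 0 = s then 1 else 0) * ∏ i : Fin m, p (f i.castSucc) (f i.succ))
    (n : ℕ) (g : Ω → (Fin n → ℝ)) (g₀ : Fin n → ℝ) :
    (∫ ω, ((∫ ω', (retTime s ω' : ℝ) ∂μ) • g₀
        - ∑ k ∈ Finset.range (retTime s ω), g (ω k)) ∂μ
      = (∫ ω', (retTime s ω' : ℝ) ∂μ) • (g₀ - ∑ x, π x • g x)) ∧
    (∫ ω, ((∫ ω', (retTime s ω' : ℝ) ∂μ) • g₀
        - ∑ k ∈ Finset.range (retTime s ω), g (ω k)) ∂μ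
      = (Z / ZS) • (g₀ - ∑ x, π x • g x)) := by
  have hexp : 0 < Real.exp (-E s) := Real.exp_pos _
  have hZpos : 0 < Z := by
    rw [hZ]
    exact Finset.sum_pos (fun y _ => Real.exp_pos _) ⟨s, Finset.mem_univ s⟩
  have hπs : 0 < π s := by rw [hπ]; positivity
  have hπ1 : ∑ x, π x = 1 := by
    simp only [hπ]
    rw [← Finset.sum_div, ← hZ, div_self hZpos.ne']
  have hst : ∀ x, ∑ y, p x y = 1 := fun x => (hstoch x).2
  have hsum : ∀ x, HasSum (fun k => μ.real (LVS.A s x k)) (π x / π s) := by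
    intro x
    refine LVS.kac p hstoch hirr s (fun x => π x / π s) (fun x => ?_) (div_self hπs.ne')
      (fun y => ?_) (fun k x => μ.real (LVS.A s x k)) (fun k x => measureReal_nonneg)
      (fun x => LVS.A_zero p s hst μ hμ x) (fun k y => LVS.A_succ p s hst μ hμ y k) x
    · simp only [hπ]; positivity
    · simp only [div_mul_eq_mul_div]
      rw [← Finset.sum_div, hπstat]
  have hA : ∀ x k, NullMeasurableSet (LVS.A s x k) μ := fun x k => LVS.A_null p s hst μ hμ x k
  have hZZ : 1 / π s = Z / ZS := by
    rw [hπ, hZS, one_div_div]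
  have hξ : ∫ ω', (retTime s ω' : ℝ) ∂μ = Z / ZS := by
    have := (LVS.tour s μ (fun x => π x / π s) hA hsum (fun _ => (1 : ℝ))).2
    simp only [Finset.sum_const, Finset.card_range, nsmul_eq_mul, mul_one, smul_eq_mul] at this
    rw [this, ← Finset.sum_div, hπ1, hZZ]
  have hg := LVS.tour s μ (fun x => π x / π s) hA hsum g
  have hmain : ∫ ω, ((∫ ω', (retTime s ω' : ℝ) ∂μ) • g₀
        - ∑ k ∈ Finset.range (retTime s ω), g (ω k)) ∂μ
      = (Z / ZS) • (g₀ - ∑ x, π x • g x) := by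
    rw [integral_sub (integrable_const _) hg.1, hg.2, hξ, integral_const, probReal_univ,
      one_smul, smul_sub, Finset.smul_sum, ← hZZ]
    congr 1
    refine Finset.sum_congr rfl fun x _ => ?_
    rw [smul_smul, one_div_mul_eq_div]
  exact ⟨by rw [hmain, hξ], hmain⟩
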